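/- Let n > 9 be a positive integer with n ≡ 2 (mod 9). Then ∑_{k=0}^{n−1} (q^{−4};q^9)_k (q^{−4};q^9)_k (q^{−1};q^9)_k · q^{9k} / (q^9;q^9)_k^3 ≡ 0 (mod Φ_n(q)^2), as rational functions of q over ℚ. -/

import Mathlib

open Finset Polynomial

/-- The q-shifted factorial `(x; q)_k = ∏_{j=0}^{k-1} (1 - x q^j)` in `RatFunc ℚ`. -/
noncomputable def qPoch (x q : RatFunc ℚ) (k : ℕ) : RatFunc ℚ :=
  ∏ j ∈ Finset.range k, (1 - x * q ^ j)

/-- `A ≡ 0 (mod P)`: `A = P · B` for some rational function `B` whose denominator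
(in lowest terms) is coprime to `P`. -/
def CongrZero (A : RatFunc ℚ) (P : Polynomial ℚ) : Prop :=
  ∃ B : RatFunc ℚ, A = algebraMap (Polynomial ℚ) (RatFunc ℚ) P * B ∧ IsCoprime B.denom P

/-- The `q`-shifted factorial in an arbitrary commutative ring. -/
def shiftedFactorial {R : Type*} [CommRing R] (x p : R) (k : ℕ) : R :=
  ∏ j ∈ Finset.range k, (1 - x * p ^ j)

section CommRing

variable {R : Type*} [CommRing R]

lemma shiftedFactorial_succ (x p : R) (k : ℕ) :
    shiftedFactorial x p (k + 1) = shiftedFactorial x p k * (1 - x * p ^ k) :=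
  Finset.prod_range_succ _ _

lemma shiftedFactorial_succ' (x p : R) (k : ℕ) :
    shiftedFactorial x p (k + 1) = (1 - x) * shiftedFactorial (x * p) p k := by
  simp only [shiftedFactorial, Finset.prod_range_succ', pow_zero, mul_one]
  rw [mul_comm]
  congr 1
  exact Finset.prod_congr rfl fun j _ => by ring

lemma shiftedFactorial_add (x p : R) (k l : ℕ) :
    shiftedFactorial x p (k + l) =
      shiftedFactorial x p k * shiftedFactorial (x * p ^ k) p l := by
  simp only [shiftedFactorial, Finset.prod_range_add]
  congr 1
  exact Finset.prod_congr rfl fun j _ => by ring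

lemma sq_dvd_one_add_pow_sub (e : R) (t : ℕ) : e ^ 2 ∣ (1 + e) ^ t - 1 - t * e := by
  induction t with
  | zero => simp
  | succ t ih =>
    obtain ⟨s, hs⟩ := ih
    refine ⟨s * (1 + e) + t, ?_⟩
    push_cast
    rw [pow_succ]
    linear_combination (1 + e) * hs

/-- First-order expansion of `(x (1 + e) ^ t; p)_k` in `e`. -/
lemma exists_sq_dvd_shiftedFactorial_sub (x p e : R) (k : ℕ) :
    ∃ D : R, ∀ t : ℕ, e ^ 2 ∣
      shiftedFactorial (x * (1 + e) ^ t) p k - shiftedFactorial x p k - t * e * D := by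
  induction k with
  | zero => exact ⟨0, fun t => by simp [shiftedFactorial]⟩
  | succ k ih =>
    obtain ⟨D, hD⟩ := ih
    refine ⟨D * (1 - x * p ^ k) - shiftedFactorial x p k * (x * p ^ k), fun t => ?_⟩
    obtain ⟨r, hr⟩ := hD t
    obtain ⟨s, hs⟩ := sq_dvd_one_add_pow_sub e t
    rw [shiftedFactorial_succ, shiftedFactorial_succ]
    refine ⟨r * (1 - x * (1 + e) ^ t * p ^ k)
      - shiftedFactorial x p k * (x * p ^ k * s)
      - t * D * (x * p ^ k) * (t + e * s), ?_⟩
    linear_combination (1 - x * (1 + e) ^ t * p ^ k) * hr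
      - (shiftedFactorial x p k + t * e * D) * (x * p ^ k) * hs

lemma sq_dvd_shiftedFactorial_combination (x y p e : R) (k : ℕ) :
    e ^ 2 ∣ 9 * (shiftedFactorial (x * (1 + e) ^ 7) p k * shiftedFactorial (x * (1 + e) ^ 7) p k
          * shiftedFactorial (y * (1 + e) ^ 4) p k)
      - 5 * (shiftedFactorial (x * (1 + e) ^ 9) p k * shiftedFactorial (x * (1 + e) ^ 9) p k
          * shiftedFactorial y p k)
      - 4 * (shiftedFactorial (x * (1 + e) ^ 9) p k * shiftedFactorial (y * (1 + e) ^ 9) p k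
          * shiftedFactorial x p k) := by
  obtain ⟨D, hD⟩ := exists_sq_dvd_shiftedFactorial_sub x p e k
  obtain ⟨E, hE⟩ := exists_sq_dvd_shiftedFactorial_sub y p e k
  obtain ⟨a, ha⟩ := hD 7
  obtain ⟨b, hb⟩ := hD 9
  obtain ⟨c, hc⟩ := hE 4
  obtain ⟨d, hd⟩ := hE 9
  generalize shiftedFactorial x p k = F at *
  generalize shiftedFactorial y p k = G at *
  rw [sub_sub, sub_eq_iff_eq_add] at ha hb hc hd
  rw [ha, hb, hc, hd, ← Ideal.mem_span_singleton, ← Ideal.Quotient.eq_zero_iff_mem]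
  have he : (Ideal.Quotient.mk (Ideal.span {e ^ 2}) e) ^ 2 = 0 := by
    rw [← map_pow, Ideal.Quotient.eq_zero_iff_mem]
    exact Ideal.mem_span_singleton_self _
  simp only [map_sub, map_add, map_mul, map_pow, map_ofNat, he, Nat.cast_ofNat, zero_mul, zero_add]
  generalize (Ideal.Quotient.mk (Ideal.span {e ^ 2})) e = e' at *
  generalize (Ideal.Quotient.mk (Ideal.span {e ^ 2})) F = F' at *
  generalize (Ideal.Quotient.mk (Ideal.span {e ^ 2})) G = G' at *
  generalize (Ideal.Quotient.mk (Ideal.span {e ^ 2})) D = D' at *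
  generalize (Ideal.Quotient.mk (Ideal.span {e ^ 2})) E = E' at *
  linear_combination (9 * (49 * D' ^ 2 * (G' + 4 * e' * E') + 56 * F' * D' * E')
    - 5 * 81 * D' ^ 2 * G' - 4 * 81 * F' * D' * E') * he

end CommRing

section Field

variable {K : Type*} [Field K]

lemma sum_shiftedFactorial_div (x p : K) (n : ℕ)
    (hp : ∀ k < n + 1, shiftedFactorial p p k ≠ 0) :
    ∑ k ∈ Finset.range (n + 1), shiftedFactorial x p k * p ^ k / shiftedFactorial p p k =
      shiftedFactorial (x * p) p n / shiftedFactorial p p n := by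
  induction n with
  | zero => simp [shiftedFactorial]
  | succ n ih =>
    rw [Finset.sum_range_succ, ih fun k hk => hp k (by omega), shiftedFactorial_succ' x,
      shiftedFactorial_succ (x * p), shiftedFactorial_succ p]
    have h := hp (n + 1) (by omega)
    rw [shiftedFactorial_succ] at h
    have h1 := left_ne_zero_of_mul h
    have h2 := right_ne_zero_of_mul h
    field_simp
    ring

/-- A terminating sum with argument `p` annihilates polynomials in `p ^ k` of degree below the
termination index. -/
lemma sum_shiftedFactorial_mul_prod_eq_zero (p : K) (n : ℕ)
    (hp : ∀ k < n, shiftedFactorial p p k ≠ 0) (c : ℕ → K) (m : ℕ) :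
    ∀ (N : ℕ) (x : K), m < N → N < n → x * p ^ N = 1 →
      ∑ k ∈ Finset.range n, shiftedFactorial x p k * p ^ k / shiftedFactorial p p k
        * ∏ i ∈ Finset.range m, (1 - c i * p ^ k) = 0 := by
  induction m with
  | zero =>
    intro N x hN hNn hx
    obtain ⟨n, rfl⟩ : ∃ l, n = l + 1 := ⟨n - 1, by omega⟩
    simp only [Finset.range_zero, Finset.prod_empty, mul_one]
    rw [sum_shiftedFactorial_div x p n hp, div_eq_zero_iff]
    left
    refine Finset.prod_eq_zero (i := N - 1) (Finset.mem_range.2 (by omega)) ?_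
    rw [mul_assoc, ← pow_succ', Nat.sub_add_cancel (by omega), hx, sub_self]
  | succ m ih =>
    intro N x hN hNn hx
    obtain ⟨N, rfl⟩ : ∃ l, N = l + 1 := ⟨N - 1, by omega⟩
    have hx0 : x ≠ 0 := left_ne_zero_of_mul (hx ▸ one_ne_zero)
    have h1 := ih (N + 1) x (by omega) hNn hx
    have h2 := ih N (x * p) (by omega) (by omega) (by rw [← hx, pow_succ]; ring)
    have key : ∀ k, shiftedFactorial x p k * (1 - x * p ^ k)
        = (1 - x) * shiftedFactorial (x * p) p k := fun k => by
      rw [← shiftedFactorial_succ, shiftedFactorial_succ']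
    calc _ = (1 - c m / x) * ∑ k ∈ Finset.range n,
              shiftedFactorial x p k * p ^ k / shiftedFactorial p p k
                * ∏ i ∈ Finset.range m, (1 - c i * p ^ k)
            + c m / x * (1 - x) * ∑ k ∈ Finset.range n,
              shiftedFactorial (x * p) p k * p ^ k / shiftedFactorial p p k
                * ∏ i ∈ Finset.range m, (1 - c i * p ^ k) := by
          rw [Finset.mul_sum, Finset.mul_sum, ← Finset.sum_add_distrib]
          refine Finset.sum_congr rfl fun k _ => ?_
          rw [Finset.prod_range_succ]
          have h : 1 - c m * p ^ k = (1 - c m / x) + c m / x * (1 - x * p ^ k) := by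
            field_simp
            ring
          rw [h]
          linear_combination (c m / x * p ^ k / shiftedFactorial p p k
            * ∏ i ∈ Finset.range m, (1 - c i * p ^ k)) * key k
      _ = 0 := by rw [h1, h2, mul_zero, mul_zero, add_zero]

lemma shiftedFactorial_pow_div (p : K) (b k : ℕ) (hb : shiftedFactorial p p b ≠ 0)
    (hk : shiftedFactorial p p k ≠ 0) :
    shiftedFactorial (p ^ (b + 1)) p k / shiftedFactorial p p k =
      (∏ i ∈ Finset.range b, (1 - p ^ (i + 1) * p ^ k)) / shiftedFactorial p p b := by
  have h1 := shiftedFactorial_add p p b k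
  have h2 := shiftedFactorial_add p p k b
  rw [add_comm b k, h2] at h1
  have h3 : ∏ i ∈ Finset.range b, (1 - p ^ (i + 1) * p ^ k)
      = shiftedFactorial (p * p ^ k) p b :=
    Finset.prod_congr rfl fun i _ => by ring
  rw [h3, div_eq_div_iff hk hb, pow_succ' p b]
  linear_combination -h1

lemma sum_shiftedFactorial_pow_eq_zero (p x : K) (n N a b : ℕ)
    (hp : ∀ k < n, shiftedFactorial p p k ≠ 0) (hab : a + b < N) (hN : N < n)
    (hx : x * p ^ N = 1) :
    ∑ k ∈ Finset.range n, shiftedFactorial (p ^ (a + 1)) p k * shiftedFactorial (p ^ (b + 1)) p k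
      * shiftedFactorial x p k * p ^ k / shiftedFactorial p p k ^ 3 = 0 := by
  have h := sum_shiftedFactorial_mul_prod_eq_zero p n hp
    (fun i => if i < a then p ^ (i + 1) else p ^ (i - a + 1)) (a + b) N x hab hN hx
  have ha := hp a (by omega)
  have hb := hp b (by omega)
  rw [← mul_zero (shiftedFactorial p p a * shiftedFactorial p p b)⁻¹, ← h, Finset.mul_sum]
  refine Finset.sum_congr rfl fun k hk => ?_
  have hk0 := hp k (Finset.mem_range.1 hk)
  have e1 := shiftedFactorial_pow_div p a k ha hk0
  have e2 := shiftedFactorial_pow_div p b k hb hk0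
  have e3 : ∏ i ∈ Finset.range (a + b),
        (1 - (if i < a then p ^ (i + 1) else p ^ (i - a + 1)) * p ^ k)
      = (∏ i ∈ Finset.range a, (1 - p ^ (i + 1) * p ^ k))
        * ∏ i ∈ Finset.range b, (1 - p ^ (i + 1) * p ^ k) := by
    rw [Finset.prod_range_add]
    congr 1
    · exact Finset.prod_congr rfl fun i hi => by rw [if_pos (Finset.mem_range.1 hi)]
    · exact Finset.prod_congr rfl fun i _ => by simp
  rw [e3]
  calc _ = (shiftedFactorial (p ^ (a + 1)) p k / shiftedFactorial p p k)
          * (shiftedFactorial (p ^ (b + 1)) p k / shiftedFactorial p p k)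
          * (shiftedFactorial x p k * p ^ k / shiftedFactorial p p k) := by field_simp
    _ = _ := by
      rw [e1, e2, mul_inv]
      ring

end Field

/-- The rational functions whose reduced denominator is coprime to `P`. -/
def coprimeDenomSubring (P : Polynomial ℚ) : Subring (RatFunc ℚ) where
  carrier := {A | IsCoprime A.denom P}
  mul_mem' {A B} hA hB := (hA.mul_left hB).of_isCoprime_of_dvd_left (RatFunc.denom_mul_dvd A B)
  one_mem' := by simp [isCoprime_one_left]
  add_mem' {A B} hA hB := (hA.mul_left hB).of_isCoprime_of_dvd_left (RatFunc.denom_add_dvd A B)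
  zero_mem' := by simp [isCoprime_one_left]
  neg_mem' {A} hA := by
    have h : -A = algebraMap (Polynomial ℚ) (RatFunc ℚ) (-1) * A := by simp
    have h2 := RatFunc.denom_mul_dvd (algebraMap (Polynomial ℚ) (RatFunc ℚ) (-1)) A
    rw [RatFunc.denom_algebraMap, one_mul, ← h] at h2
    exact IsCoprime.of_isCoprime_of_dvd_left hA h2

lemma algebraMap_mem_coprimeDenomSubring (P Q : Polynomial ℚ) :
    algebraMap (Polynomial ℚ) (RatFunc ℚ) Q ∈ coprimeDenomSubring P := by
  change IsCoprime (RatFunc.denom _) P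
  rw [RatFunc.denom_algebraMap]
  exact isCoprime_one_left

lemma inv_algebraMap_mem_coprimeDenomSubring {P Q : Polynomial ℚ} (h : IsCoprime Q P) :
    (algebraMap (Polynomial ℚ) (RatFunc ℚ) Q)⁻¹ ∈ coprimeDenomSubring P := by
  have h2 := RatFunc.denom_div_dvd (1 : Polynomial ℚ) Q
  rw [map_one, one_div] at h2
  exact h.of_isCoprime_of_dvd_left h2

lemma isCoprime_one_sub_X_pow_cyclotomic {n a : ℕ} (hn : 0 < n) (ha : ¬ n ∣ a) :
    IsCoprime (1 - X ^ a : Polynomial ℚ) (cyclotomic n ℚ) := by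
  refine IsCoprime.symm (((cyclotomic.irreducible_rat hn).coprime_iff_not_dvd).2 fun h => ha ?_)
  have hζ := Complex.isPrimitiveRoot_exp n hn.ne'
  have : NeZero (n : ℂ) := ⟨by exact_mod_cast hn.ne'⟩
  have hroot : aeval (Complex.exp (2 * Real.pi * Complex.I / n)) (cyclotomic n ℚ) = 0 := by
    rw [aeval_def, ← eval_map, map_cyclotomic]
    exact isRoot_cyclotomic_iff.2 hζ
  have h0 := (map_dvd (aeval (Complex.exp (2 * Real.pi * Complex.I / n))) h)
  rw [hroot, zero_dvd_iff] at h0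
  simp only [map_sub, map_one, map_pow, aeval_X, sub_eq_zero] at h0
  exact (hζ.pow_eq_one_iff_dvd a).1 h0.symm

lemma isCoprime_X_cyclotomic {n : ℕ} (hn : 1 < n) :
    IsCoprime (X : Polynomial ℚ) (cyclotomic n ℚ) := by
  refine (irreducible_X.coprime_iff_not_dvd).2 fun h => ?_
  rw [X_dvd_iff, cyclotomic_coeff_zero ℚ hn] at h
  exact one_ne_zero h

theorem stmt17 (n : ℕ) (hn : 0 < n) (hn9 : 9 < n) (hmod : n % 9 = 2) :
    CongrZero
      (∑ k ∈ Finset.range n,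
        qPoch ((RatFunc.X : RatFunc ℚ) ^ ((-4) : ℤ)) (RatFunc.X ^ 9) k
            * qPoch ((RatFunc.X : RatFunc ℚ) ^ ((-4) : ℤ)) (RatFunc.X ^ 9) k
            * qPoch ((RatFunc.X : RatFunc ℚ) ^ ((-1) : ℤ)) (RatFunc.X ^ 9) k
            * RatFunc.X ^ (9 * k)
          / (qPoch ((RatFunc.X : RatFunc ℚ) ^ 9) (RatFunc.X ^ 9) k) ^ 3)
      ((Polynomial.cyclotomic n ℚ) ^ 2) := by
  obtain ⟨m, rfl⟩ : ∃ m, n = 9 * m + 2 := ⟨n / 9, by omega⟩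
  have hm : 1 ≤ m := by omega
  set n := 9 * m + 2 with hn_def
  set O := coprimeDenomSubring (cyclotomic n ℚ ^ 2)
  set q : RatFunc ℚ := RatFunc.X
  have hq0 : q ≠ 0 := RatFunc.X_ne_zero
  have hqX : q = algebraMap (Polynomial ℚ) (RatFunc ℚ) X := RatFunc.algebraMap_X.symm
  have hqO : q ∈ O := hqX ▸ algebraMap_mem_coprimeDenomSubring _ _
  have hqinv : q⁻¹ ∈ O := by
    rw [hqX]
    exact inv_algebraMap_mem_coprimeDenomSubring (isCoprime_X_cyclotomic (by omega)).pow_right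
  have hfac : ∀ k < n, ∃ D : Polynomial ℚ, IsCoprime D (cyclotomic n ℚ) ∧
      shiftedFactorial (q ^ 9) (q ^ 9) k = algebraMap _ _ D := by
    intro k hk
    refine ⟨∏ j ∈ Finset.range k, (1 - X ^ (9 * (j + 1))), IsCoprime.prod_left fun j hj => ?_, ?_⟩
    · refine isCoprime_one_sub_X_pow_cyclotomic hn fun h => ?_
      have hc : Nat.Coprime n 9 := by
        rw [Nat.coprime_iff_gcd_eq_one, Nat.gcd_comm, Nat.gcd_rec, hmod]
        norm_num
      have := Nat.le_of_dvd (Nat.succ_pos j) (hc.dvd_of_dvd_mul_left h)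
      have := Finset.mem_range.1 hj
      omega
    · simp only [shiftedFactorial, map_prod, map_sub, map_one, map_pow, ← hqX]
      exact Finset.prod_congr rfl fun j _ => by ring
  have hpinv : ∀ k < n, (shiftedFactorial (q ^ 9) (q ^ 9) k)⁻¹ ∈ O := by
    intro k hk
    obtain ⟨D, hD, h⟩ := hfac k hk
    rw [h]
    exact inv_algebraMap_mem_coprimeDenomSubring hD.pow_right
  have hp : ∀ k < n, shiftedFactorial (q ^ 9) (q ^ 9) k ≠ 0 := by
    intro k hk
    obtain ⟨D, hD, h⟩ := hfac k hk
    rw [h, Ne, FaithfulSMul.algebraMap_eq_zero_iff]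
    rintro rfl
    exact (cyclotomic.irreducible_rat hn).not_isUnit (isCoprime_zero_left.1 hD)
  obtain ⟨x, hx⟩ : ∃ x, x = q⁻¹ ^ (7 * n + 4) := ⟨_, rfl⟩
  obtain ⟨y, hy⟩ : ∃ y, y = q⁻¹ ^ (4 * n + 1) := ⟨_, rfl⟩
  obtain ⟨e, he⟩ : ∃ e, e = q ^ n - 1 := ⟨_, rfl⟩
  have hqn : 1 + e = q ^ n := by rw [he]; ring
  have hx' : x * q ^ (7 * n + 4) = 1 := by rw [hx, ← mul_pow, inv_mul_cancel₀ hq0, one_pow]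
  have hy' : y * q ^ (4 * n + 1) = 1 := by rw [hy, ← mul_pow, inv_mul_cancel₀ hq0, one_pow]
  have hx7 : x * (1 + e) ^ 7 = q ^ (-4 : ℤ) := by
    rw [zpow_neg, hqn]
    refine eq_inv_of_mul_eq_one_left ?_
    rw [← hx']
    norm_cast
    ring
  have hy4 : y * (1 + e) ^ 4 = q ^ (-1 : ℤ) := by
    rw [zpow_neg, hqn]
    refine eq_inv_of_mul_eq_one_left ?_
    rw [← hy']
    norm_cast
    ring
  have hx9 : x * (1 + e) ^ 9 = (q ^ 9) ^ (2 * m - 1 + 1) := by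
    have : (q ^ n) ^ 9 = q ^ (7 * n + 4) * (q ^ 9) ^ (2 * m - 1 + 1) := by
      rw [← pow_mul, ← pow_mul, ← pow_add]
      congr 1
      omega
    rw [hqn, this, ← mul_assoc, hx', one_mul]
  have hy9 : y * (1 + e) ^ 9 = (q ^ 9) ^ (5 * m + 1) := by
    have : (q ^ n) ^ 9 = q ^ (4 * n + 1) * (q ^ 9) ^ (5 * m + 1) := by
      rw [← pow_mul, ← pow_mul, ← pow_add]
      congr 1
      omega
    rw [hqn, this, ← mul_assoc, hy', one_mul]
  have hA := sum_shiftedFactorial_pow_eq_zero (q ^ 9) y n (4 * m + 1) (2 * m - 1) (2 * m - 1) hp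
    (by omega) (by omega) (by rw [← hy', ← pow_mul]; congr 2; omega)
  have hB := sum_shiftedFactorial_pow_eq_zero (q ^ 9) x n (7 * m + 2) (2 * m - 1) (5 * m) hp
    (by omega) (by omega) (by rw [← hx', ← pow_mul]; congr 2; omega)
  have hxO : x ∈ O := hx ▸ pow_mem hqinv _
  have hyO : y ∈ O := hy ▸ pow_mem hqinv _
  have heO : e ∈ O := he ▸ sub_mem (pow_mem hqO _) (one_mem _)
  have hterm : ∀ k ∈ Finset.range n, ∃ C ∈ O,
      9 * (shiftedFactorial (q ^ (-4 : ℤ)) (q ^ 9) k * shiftedFactorial (q ^ (-4 : ℤ)) (q ^ 9) k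
          * shiftedFactorial (q ^ (-1 : ℤ)) (q ^ 9) k * (q ^ 9) ^ k
          / shiftedFactorial (q ^ 9) (q ^ 9) k ^ 3)
      - 5 * (shiftedFactorial ((q ^ 9) ^ (2 * m - 1 + 1)) (q ^ 9) k
          * shiftedFactorial ((q ^ 9) ^ (2 * m - 1 + 1)) (q ^ 9) k
          * shiftedFactorial y (q ^ 9) k * (q ^ 9) ^ k / shiftedFactorial (q ^ 9) (q ^ 9) k ^ 3)
      - 4 * (shiftedFactorial ((q ^ 9) ^ (2 * m - 1 + 1)) (q ^ 9) k
          * shiftedFactorial ((q ^ 9) ^ (5 * m + 1)) (q ^ 9) k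
          * shiftedFactorial x (q ^ 9) k * (q ^ 9) ^ k / shiftedFactorial (q ^ 9) (q ^ 9) k ^ 3)
      = e ^ 2 * C := by
    intro k hk
    obtain ⟨C, hC⟩ := sq_dvd_shiftedFactorial_combination (⟨x, hxO⟩ : O) ⟨y, hyO⟩
      (⟨q, hqO⟩ ^ 9) ⟨e, heO⟩ k
    have hC' := congrArg (Subtype.val : O → RatFunc ℚ) hC
    have hmap : ∀ z w : O, ((shiftedFactorial z w k : O) : RatFunc ℚ)
        = shiftedFactorial (z : RatFunc ℚ) w k := fun z w => by
      simp [shiftedFactorial]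
    have h9 : ((9 : O) : RatFunc ℚ) = 9 := rfl
    have h5 : ((5 : O) : RatFunc ℚ) = 5 := rfl
    have h4 : ((4 : O) : RatFunc ℚ) = 4 := rfl
    simp only [AddSubgroupClass.coe_sub, Subring.coe_mul, Subring.coe_add, Subring.coe_pow,
      Subring.coe_one, hmap, h9, h5, h4] at hC'
    rw [hx7, hy4, hx9, hy9] at hC'
    refine ⟨C * ((q ^ 9) ^ k * (shiftedFactorial (q ^ 9) (q ^ 9) k)⁻¹ ^ 3),
      mul_mem C.2 (mul_mem (pow_mem (pow_mem hqO _) _)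
        (pow_mem (hpinv k (Finset.mem_range.1 hk)) _)), ?_⟩
    rw [← mul_assoc, ← hC']
    ring
  choose! C hCO hC using hterm
  have hsum := Finset.sum_congr rfl hC
  rw [Finset.sum_sub_distrib, Finset.sum_sub_distrib, ← Finset.mul_sum, ← Finset.mul_sum,
    ← Finset.mul_sum, ← Finset.mul_sum, hA, hB, mul_zero, mul_zero, sub_zero, sub_zero] at hsum
  obtain ⟨g, hg⟩ := cyclotomic.dvd_X_pow_sub_one n ℚ
  have heg : e = algebraMap _ (RatFunc ℚ) (cyclotomic n ℚ) * algebraMap _ _ g := by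
    rw [he, ← map_mul, ← hg, hqX]
    simp
  have h9 : algebraMap (Polynomial ℚ) (RatFunc ℚ) (Polynomial.C (1 / 9)) * 9 = 1 := by
    have : (9 : RatFunc ℚ) = algebraMap (Polynomial ℚ) (RatFunc ℚ) (Polynomial.C 9) := by
      simp
    rw [this, ← map_mul, ← Polynomial.C_mul]
    norm_num
  refine ⟨algebraMap (Polynomial ℚ) _ (Polynomial.C (1 / 9)) * (algebraMap _ _ g ^ 2
    * ∑ k ∈ Finset.range n, C k), ?_, ?_⟩
  · simp only [pow_mul q 9]
    rw [heg] at hsum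
    change ∑ k ∈ Finset.range n, shiftedFactorial (q ^ (-4 : ℤ)) (q ^ 9) k
      * shiftedFactorial (q ^ (-4 : ℤ)) (q ^ 9) k * shiftedFactorial (q ^ (-1 : ℤ)) (q ^ 9) k
      * (q ^ 9) ^ k / shiftedFactorial (q ^ 9) (q ^ 9) k ^ 3 = _
    rw [map_pow]
    linear_combination algebraMap (Polynomial ℚ) (RatFunc ℚ) (Polynomial.C (1 / 9)) * hsum
      - (∑ k ∈ Finset.range n, shiftedFactorial (q ^ (-4 : ℤ)) (q ^ 9) k
      * shiftedFactorial (q ^ (-4 : ℤ)) (q ^ 9) k * shiftedFactorial (q ^ (-1 : ℤ)) (q ^ 9) k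
      * (q ^ 9) ^ k / shiftedFactorial (q ^ 9) (q ^ 9) k ^ 3) * h9
  · exact mul_mem (algebraMap_mem_coprimeDenomSubring _ _)
      (mul_mem (pow_mem (algebraMap_mem_coprimeDenomSubring _ _) _) (sum_mem hCO))
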